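/- Let S be a k-spanner and let (H, H') ∈ Λ_μ(S). Then both central vertices of S are saturated by H and are saturated by H'. -/

import Mathlib

open Finset

section Defs
variable {V : Type*}

/-- A matching: a set of edges, pairwise non-adjacent. -/
def IsMatchingSet (G : SimpleGraph V) (M : Finset (Sym2 V)) : Prop :=
  ↑M ⊆ G.edgeSet ∧ ∀ e ∈ M, ∀ f ∈ M, e ≠ f → ∀ v : V, v ∈ e → v ∉ f

/-- A vertex is saturated by a matching if some edge of it is incident to the vertex. -/
def Saturates (M : Finset (Sym2 V)) (v : V) : Prop :=
  ∃ e ∈ M, v ∈ e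

/-- ν(G): maximum size of a matching. -/
noncomputable def nuG (G : SimpleGraph V) : ℕ :=
  sSup {n | ∃ M : Finset (Sym2 V), IsMatchingSet G M ∧ M.card = n}

/-- λ(G): maximum of |H| + |H'| over pairs of disjoint matchings. -/
noncomputable def lamG (G : SimpleGraph V) : ℕ :=
  sSup {n | ∃ H H' : Finset (Sym2 V), IsMatchingSet G H ∧ IsMatchingSet G H' ∧
    Disjoint H H' ∧ H.card + H'.card = n}

/-- Λ(G): set of pairs of disjoint matchings realizing λ(G). -/
def LambdaSet (G : SimpleGraph V) : Set (Finset (Sym2 V) × Finset (Sym2 V)) :=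
  {p | IsMatchingSet G p.1 ∧ IsMatchingSet G p.2 ∧ Disjoint p.1 p.2 ∧
    p.1.card + p.2.card = lamG G}

/-- μ(G): maximum of |H| over pairs (H, H') ∈ Λ(G). -/
noncomputable def muG (G : SimpleGraph V) : ℕ :=
  sSup {n | ∃ p ∈ LambdaSet G, p.1.card = n}

/-- Λ_μ(G): pairs in Λ(G) with |H| = μ(G). -/
def LambdaMuSet (G : SimpleGraph V) : Set (Finset (Sym2 V) × Finset (Sym2 V)) :=
  {p | p ∈ LambdaSet G ∧ p.1.card = muG G}

end Defs

/-- Vertex type of a k-spanner: two central vertices and 4+k legs of two vertices each. -/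
abbrev SpannerV (k : ℕ) : Type := Fin 2 ⊕ (Fin (4 + k) × Fin 2)

/-- The k-spanner determined by the attachment function `attach` assigning each of
the 4+k legs to one of the two central vertices.  Leg `i` consists of the middle
vertex `Sum.inr (i, 0)` and the leaf `Sum.inr (i, 1)`; its inner edge joins the
central vertex `Sum.inl (attach i)` to `Sum.inr (i, 0)` and its outer edge joins
`Sum.inr (i, 0)` to `Sum.inr (i, 1)`. The two central vertices are adjacent. -/
def spannerGraph (k : ℕ) (attach : Fin (4 + k) → Fin 2) : SimpleGraph (SpannerV k) :=
  SimpleGraph.fromRel (fun u v =>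
    (u = Sum.inl 0 ∧ v = Sum.inl 1) ∨
    (∃ i : Fin (4 + k), u = Sum.inl (attach i) ∧ v = Sum.inr (i, 0)) ∨
    (∃ i : Fin (4 + k), u = Sum.inr (i, 0) ∧ v = Sum.inr (i, 1)))

/-- `attach` describes a genuine k-spanner: at least two legs attached to each
central vertex (the base spanner already has two legs at each). -/
def IsKSpannerAttach (k : ℕ) (attach : Fin (4 + k) → Fin 2) : Prop :=
  2 ≤ (Finset.univ.filter fun i => attach i = 0).card ∧
  2 ≤ (Finset.univ.filter fun i => attach i = 1).card

/-- The inner edge of leg `i`. -/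
def innerEdge {k : ℕ} (attach : Fin (4 + k) → Fin 2) (i : Fin (4 + k)) : Sym2 (SpannerV k) :=
  s(Sum.inl (attach i), Sum.inr (i, 0))

/-- The outer edge of leg `i`. -/
def outerEdge {k : ℕ} (i : Fin (4 + k)) : Sym2 (SpannerV k) :=
  s(Sum.inr (i, 0), Sum.inr (i, 1))

theorem outerEdge_injective {k : ℕ} : Function.Injective (outerEdge (k := k)) := by
  intro i j h
  simpa [outerEdge] using h

theorem innerEdge_injective {k : ℕ} (attach : Fin (4 + k) → Fin 2) :
    Function.Injective (innerEdge attach) := by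
  intro i j h
  have h' : attach i = attach j ∧ i = j := by simpa [innerEdge] using h
  exact h'.2

theorem innerEdge_ne_outerEdge {k : ℕ} (attach : Fin (4 + k) → Fin 2) (i j : Fin (4 + k)) :
    innerEdge attach i ≠ outerEdge j := by
  simp [innerEdge, outerEdge]

theorem innerEdge_mem_edgeSet {k : ℕ} (attach : Fin (4 + k) → Fin 2) (i : Fin (4 + k)) :
    innerEdge attach i ∈ (spannerGraph k attach).edgeSet := by
  simp [innerEdge, spannerGraph]

theorem outerEdge_mem_edgeSet {k : ℕ} (attach : Fin (4 + k) → Fin 2) (i : Fin (4 + k)) :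
    outerEdge i ∈ (spannerGraph k attach).edgeSet := by
  simp [outerEdge, spannerGraph]

/-- Every edge of a spanner is an outer edge or is incident to a central vertex. -/
theorem eq_outerEdge_or_exists_inl_mem {k : ℕ} {attach : Fin (4 + k) → Fin 2}
    {e : Sym2 (SpannerV k)} (he : e ∈ (spannerGraph k attach).edgeSet) :
    (∃ i, e = outerEdge i) ∨ ∃ c : Fin 2, Sum.inl c ∈ e := by
  induction e using Sym2.ind with
  | _ u v =>
    rw [SimpleGraph.mem_edgeSet, spannerGraph, SimpleGraph.fromRel_adj] at he
    rcases he.2 with (⟨rfl, rfl⟩ | ⟨i, rfl, rfl⟩ | ⟨i, rfl, rfl⟩) |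
      (⟨rfl, rfl⟩ | ⟨i, rfl, rfl⟩ | ⟨i, rfl, rfl⟩)
    · exact Or.inr ⟨0, by simp⟩
    · exact Or.inr ⟨attach i, by simp⟩
    · exact Or.inl ⟨i, rfl⟩
    · exact Or.inr ⟨0, by simp⟩
    · exact Or.inr ⟨attach i, by simp⟩
    · exact Or.inl ⟨i, Sym2.eq_swap⟩

/-- The edges of a matching that are not outer edges number at most the central vertices in any
set containing all the saturated ones. -/
theorem card_sdiff_outerEdge_le {k : ℕ} {attach : Fin (4 + k) → Fin 2}
    {M : Finset (Sym2 (SpannerV k))} (hM : IsMatchingSet (spannerGraph k attach) M)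
    (C : Finset (Fin 2)) (hC : ∀ c, Saturates M (Sum.inl c : SpannerV k) → c ∈ C) :
    (M \ univ.image outerEdge).card ≤ C.card := by
  have hex : ∀ e ∈ M \ univ.image outerEdge, ∃ c : Fin 2, (Sum.inl c : SpannerV k) ∈ e := by
    intro e he
    rw [mem_sdiff] at he
    rcases eq_outerEdge_or_exists_inl_mem (hM.1 he.1) with ⟨i, rfl⟩ | h
    · exact absurd (mem_image_of_mem _ (mem_univ i)) he.2
    · exact h
  choose! f hf using hex
  refine card_le_card_of_injOn f (fun e he => hC _ ⟨e, (mem_sdiff.1 he).1, hf e he⟩) ?_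
  intro e he e' he' h
  by_contra hne
  exact hM.2 e (mem_sdiff.1 he).1 e' (mem_sdiff.1 he').1 hne _ (hf e he) (h ▸ hf e' he')

theorem card_add_card_le {k : ℕ}
    {H H' : Finset (Sym2 (SpannerV k))} (hd : Disjoint H H') :
    H.card + H'.card ≤ (4 + k) + (H \ univ.image outerEdge).card +
      (H' \ univ.image outerEdge).card := by
  have hO : (univ.image (outerEdge (k := k))).card = 4 + k := by
    rw [card_image_of_injective _ outerEdge_injective, card_univ, Fintype.card_fin]
  have hsub : H ∪ H' ⊆ univ.image outerEdge ∪ H \ univ.image outerEdge ∪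
      H' \ univ.image outerEdge := by
    intro e he
    simp only [mem_union, mem_sdiff] at he ⊢
    tauto
  have hle := (card_le_card hsub).trans ((card_union_le _ _).trans (Nat.add_le_add_right
    (card_union_le _ _) _))
  rwa [card_union_of_disjoint hd, hO] at hle

/-- One inner edge at each central vertex together with outer edges of other legs. -/
def spannerMatching {k : ℕ} (attach : Fin (4 + k) → Fin 2) (x y : Fin (4 + k))
    (S : Finset (Fin (4 + k))) : Finset (Sym2 (SpannerV k)) :=
  ({x, y} : Finset (Fin (4 + k))).image (innerEdge attach) ∪ S.image outerEdge

theorem isMatchingSet_spannerMatching {k : ℕ} {attach : Fin (4 + k) → Fin 2}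
    {x y : Fin (4 + k)} {S : Finset (Fin (4 + k))} (hxy : attach x ≠ attach y)
    (hx : x ∉ S) (hy : y ∉ S) :
    IsMatchingSet (spannerGraph k attach) (spannerMatching attach x y S) := by
  constructor
  · intro e he
    simp only [spannerMatching, coe_union, coe_image, Set.mem_union, Set.mem_image] at he
    rcases he with ⟨i, -, rfl⟩ | ⟨i, -, rfl⟩
    · exact innerEdge_mem_edgeSet attach i
    · exact outerEdge_mem_edgeSet attach i
  · have hxy' : x ≠ y := fun h => hxy (h ▸ rfl)
    intro e he f hf hef v hve hvf
    simp only [spannerMatching, mem_union, mem_image, mem_insert, mem_singleton] at he hf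
    rcases he with ⟨i, hi, rfl⟩ | ⟨i, hi, rfl⟩ <;> rcases hf with ⟨j, hj, rfl⟩ | ⟨j, hj, rfl⟩ <;>
      simp only [innerEdge, outerEdge, Sym2.mem_iff] at hve hvf hef <;> grind

theorem card_spannerMatching {k : ℕ} (attach : Fin (4 + k) → Fin 2)
    {x y : Fin (4 + k)} (S : Finset (Fin (4 + k))) (hxy : x ≠ y) :
    (spannerMatching attach x y S).card = 2 + S.card := by
  rw [spannerMatching, card_union_of_disjoint,
    card_image_of_injective _ (innerEdge_injective attach),
    card_image_of_injective _ outerEdge_injective, card_pair hxy]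
  rw [disjoint_left]
  intro e he hf
  obtain ⟨i, -, rfl⟩ := mem_image.1 he
  obtain ⟨j, -, h⟩ := mem_image.1 hf
  exact innerEdge_ne_outerEdge attach i j h.symm

theorem disjoint_spannerMatching {k : ℕ} (attach : Fin (4 + k) → Fin 2)
    {x y x' y' : Fin (4 + k)} {S S' : Finset (Fin (4 + k))}
    (h : Disjoint ({x, y} : Finset (Fin (4 + k))) {x', y'}) (hS : Disjoint S S') :
    Disjoint (spannerMatching attach x y S) (spannerMatching attach x' y' S') := by
  simp only [spannerMatching, disjoint_union_left, disjoint_union_right,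
    disjoint_image (innerEdge_injective attach), disjoint_image outerEdge_injective]
  refine ⟨⟨h, ?_⟩, ?_, hS⟩ <;> rw [disjoint_left] <;> intro e he hf <;>
    obtain ⟨i, -, rfl⟩ := mem_image.1 he <;> obtain ⟨j, -, h⟩ := mem_image.1 hf
  · exact innerEdge_ne_outerEdge attach j i h
  · exact innerEdge_ne_outerEdge attach i j h.symm

theorem card_add_card_le_lamG {V : Type*} [Fintype V] {G : SimpleGraph V}
    {H H' : Finset (Sym2 V)} (hH : IsMatchingSet G H) (hH' : IsMatchingSet G H')
    (hd : Disjoint H H') : H.card + H'.card ≤ lamG G := by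
  classical
  refine le_csSup ⟨Fintype.card (Sym2 V) + Fintype.card (Sym2 V), ?_⟩ ⟨H, H', hH, hH', hd, rfl⟩
  rintro n ⟨M, M', -, -, -, rfl⟩
  exact Nat.add_le_add (card_le_univ M) (card_le_univ M')

theorem le_lamG_spannerGraph {k : ℕ} {attach : Fin (4 + k) → Fin 2}
    (hat : IsKSpannerAttach k attach) : (4 + k) + 4 ≤ lamG (spannerGraph k attach) := by
  obtain ⟨x, hx, x', hx', hxx⟩ := one_lt_card.1 hat.1
  obtain ⟨y, hy, y', hy', hyy⟩ := one_lt_card.1 hat.2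
  simp only [mem_filter, mem_univ, true_and] at hx hx' hy hy'
  have hne : ∀ {i j}, attach i = 0 → attach j = 1 → i ≠ j := by grind
  have hxy := hne hx hy
  have hxy' := hne hx hy'
  have hx'y := hne hx' hy
  have hx'y' := hne hx' hy'
  have hle := card_add_card_le_lamG
    (isMatchingSet_spannerMatching (attach := attach) (x := x) (y := y) (S := {x, y}ᶜ)
      (by simp [hx, hy]) (by simp) (by simp))
    (isMatchingSet_spannerMatching (attach := attach) (x := x') (y := y') (S := {x, y})
      (by simp [hx', hy']) (by grind) (by grind))
    (disjoint_spannerMatching attach (by simp; grind) disjoint_compl_left)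
  rw [card_spannerMatching attach _ hxy, card_spannerMatching attach _ hx'y', card_compl,
    card_pair hxy, Fintype.card_fin] at hle
  omega

/-- For any (H, H') ∈ Λ_μ of a k-spanner, both central vertices are saturated by
H and by H'. -/
theorem stmt6 (k : ℕ) (attach : Fin (4 + k) → Fin 2) (hat : IsKSpannerAttach k attach)
    (H H' : Finset (Sym2 (SpannerV k)))
    (hHH : (H, H') ∈ LambdaMuSet (spannerGraph k attach)) :
    ∀ c : Fin 2, Saturates H (Sum.inl c : SpannerV k) ∧ Saturates H' (Sum.inl c : SpannerV k) := by
  obtain ⟨⟨hM, hM', hd, hcard⟩, -⟩ := hHH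
  dsimp only at hM hM' hd hcard
  have hlow := le_lamG_spannerGraph hat
  have hup := card_add_card_le hd
  have hu : ∀ {M}, IsMatchingSet (spannerGraph k attach) M →
      (M \ univ.image outerEdge).card ≤ 2 := fun h =>
    card_sdiff_outerEdge_le h univ fun c _ => mem_univ c
  have hlt : ∀ {M}, IsMatchingSet (spannerGraph k attach) M → ∀ c : Fin 2,
      ¬ Saturates M (Sum.inl c : SpannerV k) → (M \ univ.image outerEdge).card ≤ 1 := by
    intro M h c hc
    have hle := card_sdiff_outerEdge_le h (univ.erase c) fun d hd' =>
      mem_erase.2 ⟨fun hdc => hc (hdc ▸ hd'), mem_univ d⟩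
    simpa using hle
  have h2 := hu hM
  have h2' := hu hM'
  intro c
  constructor
  · by_contra hc
    have := hlt hM c hc
    omega
  · by_contra hc
    have := hlt hM' c hc
    omega
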